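/- arXiv:1607.05237 — 2 statements merged into one kernel-verified Lean document; each statement's English description precedes it below -/
import Mathlib

section
/- Let t : (ℕ → τ) → ℕ be fixed. Define H^t G H s f = G s if t ŝ < |s| and H^t G H s f = H s f otherwise, and define Φ^t Δ G H s = Δ (fun s' => Ψ (t ŝ') G H s') (H^t G H) s. Then for every bar S which secures t and every functional Δ satisfying GenBR_S(Δ), the functional Φ^t Δ satisfies Spector's bar-recursion equation for Y = t. (Theorem 2.4: Spector's bar recursion is definable from general bar recursion for any bar securing the stopping functional.) -/
/-- Extension of a finite sequence `s` by infinitely many copies of `z` (the "hat"). -/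
def ext {τ : Type*} (z : τ) (s : List τ) : ℕ → τ := fun n => s.getD n z

/-- Concatenation `s * β` of a finite sequence with an infinite one. -/
def cat {τ : Type*} (s : List τ) (β : ℕ → τ) : ℕ → τ :=
  fun n => if h : n < s.length then s[n] else β (n - s.length)

/-- `S` is a bar: decidable, monotone, and hit by every infinite sequence. -/
def IsBar {τ : Type*} (S : List τ → Prop) : Prop :=
  (∀ s, S s ∨ ¬ S s) ∧ (∀ s t : List τ, S s → S (s ++ t)) ∧
    (∀ α : ℕ → τ, ∃ n : ℕ, S ((List.range n).map α))

/-- `S` secures `Y`: whenever `S s` holds, `fun β => Y (s * β)` is constant. -/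
def Secures {τ : Type*} (S : List τ → Prop) (Y : (ℕ → τ) → ℕ) : Prop :=
  ∀ s, S s → ∀ β β' : ℕ → τ, Y (cat s β) = Y (cat s β')

/-- The general bar-recursion equation for the bar `S`. -/
def GenBR {τ σ : Type*} (S : List τ → Prop)
    (Δ : (List τ → σ) → (List τ → (τ → σ) → σ) → List τ → σ) : Prop :=
  ∀ G H s, (S s → Δ G H s = G s) ∧
    (¬ S s → Δ G H s = H s (fun x => Δ G H (s ++ [x])))

/-- Spector's bar-recursion equation for the stopping functional `Y`. -/
def SpectorBR {τ σ : Type*} (z : τ) (Y : (ℕ → τ) → ℕ)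
    (ξ : (List τ → σ) → (List τ → (τ → σ) → σ) → List τ → σ) : Prop :=
  ∀ G H s, (Y (ext z s) < s.length → ξ G H s = G s) ∧
    (s.length ≤ Y (ext z s) → ξ G H s = H s (fun x => ξ G H (s ++ [x])))

/-- The auxiliary functional `φ`. -/
def phi {τ σ : Type*} (G : List τ → σ) (H : List τ → (τ → σ) → σ) : ℕ → List τ → σ
  | 0 => G
  | n + 1 => fun s => H s (fun x => phi G H n (s ++ [x]))

/-- The functional `Ψ`, bar recursion for a constant stopping functional. -/
def psi {τ σ : Type*} (k : ℕ) (G : List τ → σ) (H : List τ → (τ → σ) → σ)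
    (s : List τ) : σ :=
  if s.length > k then G s else phi G H (k + 1 - s.length) s

/-- The functional `H^t`. -/
def Hdag {τ σ : Type*} (z : τ) (t : (ℕ → τ) → ℕ) (G : List τ → σ)
    (H : List τ → (τ → σ) → σ) (s : List τ) (f : τ → σ) : σ :=
  if t (ext z s) < s.length then G s else H s f

/-- The functional `Φ^t`. -/
def PhiT {τ σ : Type*} (z : τ) (t : (ℕ → τ) → ℕ)
    (Δ : (List τ → σ) → (List τ → (τ → σ) → σ) → List τ → σ)
    (G : List τ → σ) (H : List τ → (τ → σ) → σ) (s : List τ) : σ :=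
  Δ (fun s' => psi (t (ext z s')) G H s') (Hdag z t G H) s

theorem ext_append {τ : Type*} (z : τ) (s u : List τ) :
    ext z (s ++ u) = cat s (ext z u) := by
  funext n
  by_cases h : n < s.length
  · simp [ext, cat, h, List.getElem?_append_left]
  · simp [ext, cat, h, List.getElem?_append_right (not_lt.mp h)]

theorem psi_of_lt {τ σ : Type*} {k : ℕ} (G : List τ → σ) (H : List τ → (τ → σ) → σ)
    {s : List τ} (h : k < s.length) : psi k G H s = G s :=
  if_pos h

theorem psi_of_le {τ σ : Type*} {k : ℕ} (G : List τ → σ) (H : List τ → (τ → σ) → σ)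
    {s : List τ} (h : s.length ≤ k) :
    psi k G H s = H s (fun x => psi k G H (s ++ [x])) := by
  have eq_phi (u : List τ) : psi k G H u = phi G H (k + 1 - u.length) u := by
    unfold psi
    split_ifs with hu
    · rw [Nat.sub_eq_zero_of_le hu, phi]
    · rfl
  simp only [eq_phi, List.length_append, List.length_singleton, Nat.add_sub_add_right]
  rw [Nat.succ_sub h, phi]

/-- Once `s` lies in a securing set, extending `s` does not change the value at its hat. -/
theorem Secures.apply_ext_append {τ : Type*} {S : List τ → Prop} {Y : (ℕ → τ) → ℕ}
    (h : Secures S Y) (z : τ) {s : List τ} (hs : S s) (u : List τ) :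
    Y (ext z (s ++ u)) = Y (ext z s) := by
  conv_rhs => rw [← List.append_nil s]
  rw [ext_append, ext_append]
  exact h s hs _ _

/-- Theorem 2.4: for every bar `S` securing `t` and every `Δ` satisfying the general
bar-recursion equation for `S`, the functional `Φ^t Δ` satisfies Spector's
bar-recursion equation for `Y = t`. -/
theorem spector_from_general_bar_recursion {τ σ : Type*} (z : τ) (t : (ℕ → τ) → ℕ)
    (S : List τ → Prop) (hbar : IsBar S) (hsec : Secures S t)
    (Δ : (List τ → σ) → (List τ → (τ → σ) → σ) → List τ → σ)
    (hΔ : GenBR S Δ) :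
    SpectorBR z t (PhiT z t Δ) := by
  intro G H s
  by_cases hs : S s
  · have hPhi (u : List τ) (hu : S u) : PhiT z t Δ G H u = psi (t (ext z u)) G H u :=
      (hΔ _ _ u).1 hu
    rw [hPhi s hs]
    refine ⟨psi_of_lt G H, fun h => ?_⟩
    rw [psi_of_le G H h]
    congr 1
    funext x
    rw [hPhi _ (hbar.2.1 s [x] hs), hsec.apply_ext_append z hs]
  · have hPhi : PhiT z t Δ G H s = Hdag z t G H s (fun x => PhiT z t Δ G H (s ++ [x])) :=
      (hΔ _ _ s).2 hs
    rw [hPhi]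
    exact ⟨fun h => if_pos h, fun h => if_neg h.not_gt⟩
end

section
/- Let τ = ℕ with 0_τ = 0 and let g : (ℕ → ℕ) → ℕ. Suppose S_x is a bar securing g. Define S s := S_x s ∧ g ŝ < |s|. Then S is a bar and S secures the functional fun α => α (g α). (Key step of the α-case in the proof of Theorem 3.3.) -/
theorem ext_eq_cat {τ : Type*} (z : τ) (s : List τ) : ext z s = cat s (fun _ => z) := by
  funext n
  by_cases h : n < s.length <;> simp [ext, cat, h]

theorem cat_append {τ : Type*} (s t : List τ) (β : ℕ → τ) :
    cat (s ++ t) β = cat s (cat t β) := by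
  funext n
  simp only [cat, List.length_append, List.getElem_append]
  split_ifs <;> first | rfl | omega | (congr 1; omega)

theorem cat_map_range {τ : Type*} (α : ℕ → τ) (n : ℕ) :
    cat ((List.range n).map α) (fun k => α (n + k)) = α := by
  funext m
  by_cases h : m < n
  · simp [cat, h]
  · simp [cat, h, Nat.add_sub_cancel' (not_lt.mp h)]

theorem cat_of_lt {τ : Type*} {s : List τ} {n : ℕ} (h : n < s.length) (β : ℕ → τ) :
    cat s β n = s[n] := dif_pos h

theorem Secures.apply_cat_eq_apply_ext {τ : Type*} {S : List τ → Prop} {Y : (ℕ → τ) → ℕ}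
    (hS : Secures S Y) {s : List τ} (hs : S s) (z : τ) (β : ℕ → τ) :
    Y (cat s β) = Y (ext z s) := by
  rw [ext_eq_cat]
  exact hS s hs _ _

theorem IsBar.map_range_of_le {τ : Type*} {S : List τ → Prop} (hS : IsBar S) {α : ℕ → τ}
    {m n : ℕ} (hmn : m ≤ n) (h : S ((List.range m).map α)) : S ((List.range n).map α) := by
  obtain ⟨k, rfl⟩ := Nat.exists_eq_add_of_le hmn
  rw [List.range_add, List.map_append]
  exact hS.2.1 _ _ h

/-- Key step of the `α`-case in the proof of Theorem 3.3 (`τ = ℕ`, `0_τ = 0`):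
if `S_x` is a bar securing `g`, then `S s := S_x s ∧ g ŝ < |s|` is a bar securing
`fun α => α (g α)`. -/
theorem alpha_case_bar (g : (ℕ → ℕ) → ℕ) (Sx : List ℕ → Prop)
    (hbar : IsBar Sx) (hsec : Secures Sx g) :
    IsBar (fun s : List ℕ => Sx s ∧ g (ext 0 s) < s.length) ∧
    Secures (fun s : List ℕ => Sx s ∧ g (ext 0 s) < s.length)
      (fun α : ℕ → ℕ => α (g α)) := by
  refine ⟨⟨fun s => em _, ?_, fun α => ?_⟩, ?_⟩
  · rintro s t ⟨hs, hlt⟩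
    refine ⟨hbar.2.1 s t hs, ?_⟩
    rw [ext_eq_cat, cat_append, hsec.apply_cat_eq_apply_ext hs 0, List.length_append]
    omega
  · obtain ⟨m, hm⟩ := hbar.2.2 α
    have hn := hbar.map_range_of_le (le_max_left m (g α + 1)) hm
    refine ⟨max m (g α + 1), hn, ?_⟩
    rw [← hsec.apply_cat_eq_apply_ext hn 0, cat_map_range, List.length_map, List.length_range]
    omega
  · rintro s ⟨hs, hlt⟩ β β'
    simp only [hsec.apply_cat_eq_apply_ext hs 0, cat_of_lt hlt]
end
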